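/- arXiv:2603.05466 — 3 statements merged into one kernel-verified Lean document; each statement's English description precedes it below -/
import Mathlib

section
/- Let H and K be complex Hilbert spaces and let T : H →ₗ.[ℂ] K be a densely defined (possibly unbounded) linear operator such that ‖h‖ ≤ ‖T h‖ for every h in the domain of T. If f belongs to the domain of T and saturates this bound, i.e. ‖f‖ = ‖T f‖, then the vector T f lies in the domain of the adjoint operator T† : K →ₗ.[ℂ] H and T†(T f) = f. In particular, f is a fixed point (eigenvector with eigenvalue 1) of the positive operator T†T. -/
open scoped InnerProductSpace

section Saturation

variable {𝕜 V E F : Type*} [RCLike 𝕜] [AddCommGroup V] [Module 𝕜 V]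
  [SeminormedAddCommGroup E] [InnerProductSpace 𝕜 E]
  [SeminormedAddCommGroup F] [InnerProductSpace 𝕜 F]

/-- First-order condition at a minimizer of the quadratic form `‖B v‖ ^ 2 - ‖A v‖ ^ 2`. -/
theorem re_inner_map_eq_of_norm_le_of_norm_eq (A : V →ₗ[𝕜] E) (B : V →ₗ[𝕜] F)
    (hle : ∀ v, ‖A v‖ ≤ ‖B v‖) {f : V} (hf : ‖A f‖ = ‖B f‖) (v : V) :
    RCLike.re (inner 𝕜 (A f) (A v)) = RCLike.re (inner 𝕜 (B f) (B v)) := by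
  have hquad : ∀ t : ℝ, 0 ≤ (‖B v‖ ^ 2 - ‖A v‖ ^ 2) * (t * t) +
      2 * (RCLike.re (inner 𝕜 (B f) (B v)) - RCLike.re (inner 𝕜 (A f) (A v))) * t + 0 := by
    intro t
    have h := pow_le_pow_left₀ (norm_nonneg _) (hle (f + (t : 𝕜) • v)) 2
    simp only [map_add, map_smul, norm_add_sq (𝕜 := 𝕜), inner_smul_right,
      RCLike.re_ofReal_mul, norm_smul, RCLike.norm_ofReal, mul_pow, sq_abs, hf] at h
    linarith
  have hdiscrim := discrim_le_zero hquad
  rw [discrim] at hdiscrim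
  nlinarith [sq_nonneg (RCLike.re (inner 𝕜 (B f) (B v)) - RCLike.re (inner 𝕜 (A f) (A v)))]

/-- If `‖A v‖ ≤ ‖B v‖` for all `v`, with equality at `f`, then the sesquilinear forms induced by
`A` and `B` agree whenever one argument is `f`. -/
theorem inner_map_eq_of_norm_le_of_norm_eq (A : V →ₗ[𝕜] E) (B : V →ₗ[𝕜] F)
    (hle : ∀ v, ‖A v‖ ≤ ‖B v‖) {f : V} (hf : ‖A f‖ = ‖B f‖) (v : V) :
    inner 𝕜 (A f) (A v) = inner 𝕜 (B f) (B v) := by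
  set d := inner 𝕜 (A f) (A v) - inner 𝕜 (B f) (B v) with hd
  have h := re_inner_map_eq_of_norm_le_of_norm_eq A B hle hf (starRingEnd 𝕜 d • v)
  rw [map_smul, map_smul, inner_smul_right, inner_smul_right, ← sub_eq_zero, ← map_sub,
    ← mul_sub, ← hd, RCLike.conj_mul, ← RCLike.ofReal_pow, RCLike.ofReal_re] at h
  exact sub_eq_zero.mp (norm_eq_zero.mp (eq_zero_of_pow_eq_zero h))

end Saturation

/-- **Saturation of a Poincaré-type bound forces an eigenvector relation.**
If `T` is a densely defined (possibly unbounded) operator between complex Hilbert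
spaces with `‖h‖ ≤ ‖T h‖` on its domain, and `f` in the domain saturates the bound
(`‖f‖ = ‖T f‖`), then `T f` lies in the domain of the adjoint `T†` and `T† (T f) = f`. -/
theorem saturator_is_eigenvector
    {H K : Type*} [NormedAddCommGroup H] [InnerProductSpace ℂ H] [CompleteSpace H]
    [NormedAddCommGroup K] [InnerProductSpace ℂ K] [CompleteSpace K]
    (T : H →ₗ.[ℂ] K) (hdense : Dense (T.domain : Set H))
    (hineq : ∀ h : T.domain, ‖(h : H)‖ ≤ ‖T h‖)
    (f : T.domain) (hsat : ‖(f : H)‖ = ‖T f‖) :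
    ∃ hmem : T f ∈ T.adjoint.domain, T.adjoint ⟨T f, hmem⟩ = (f : H) := by
  have hinner : ∀ h : T.domain, inner ℂ (f : H) (h : H) = inner ℂ (T f) (T h) :=
    inner_map_eq_of_norm_le_of_norm_eq T.domain.subtype T.toFun hineq hsat
  have hmem := LinearPMap.mem_adjoint_domain_of_exists (T f) ⟨(f : H), hinner⟩
  exact ⟨hmem, LinearPMap.adjoint_apply_eq hdense ⟨T f, hmem⟩ hinner⟩
end

section
/- Let A be a unital associative ℂ-algebra, τ : A → ℂ a ℂ-linear functional with τ(1) = 1, and δ : A → A ⊗[ℂ] A a ℂ-linear map satisfying the Leibniz rule δ(x y) = δ(x) · (1 ⊗ y) + (x ⊗ 1) · δ(y) for all x, y ∈ A, where A ⊗[ℂ] A carries its canonical algebra structure. Suppose f ∈ A satisfies δ(f) = 1 ⊗ 1 and the Stein identity τ(f^{m+1}) = (τ ⊗ τ)(δ(f^m)) for every integer m ≥ 0, where τ ⊗ τ : A ⊗[ℂ] A → ℂ is the linear map induced by (a, b) ↦ τ(a) τ(b). Then the moments of f are those of the standard semicircle law: τ(f^{2k}) = Catalan(k) and τ(f^{2k+1})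 = 0 for every natural number k. -/
open scoped TensorProduct

/-- The linear functional `τ ⊗ τ : A ⊗[ℂ] A → ℂ` induced by `(a, b) ↦ τ(a)·τ(b)`. -/
noncomputable def tensorState {A : Type*} [Ring A] [Algebra ℂ A]
    (τ : A →ₗ[ℂ] ℂ) : A ⊗[ℂ] A →ₗ[ℂ] ℂ :=
  (TensorProduct.lid ℂ ℂ).toLinearMap.comp (TensorProduct.map τ τ)

/-- A linear map obeying the Leibniz rule with `δ f = 1 ⊗ 1` acts on powers of `f` as the free
difference quotient. -/
theorem leibniz_map_pow_succ {R A : Type*} [CommRing R] [Ring A] [Algebra R A]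
    (δ : A →ₗ[R] A ⊗[R] A)
    (hLeib : ∀ x y : A, δ (x * y) = δ x * ((1 : A) ⊗ₜ[R] y) + (x ⊗ₜ[R] (1 : A)) * δ y)
    {f : A} (hf : δ f = (1 : A) ⊗ₜ[R] (1 : A)) (m : ℕ) :
    δ (f ^ (m + 1)) = ∑ p ∈ Finset.HasAntidiagonal.antidiagonal m, (f ^ p.1) ⊗ₜ[R] (f ^ p.2) := by
  induction m with
  | zero => simp [hf]
  | succ m ih =>
    rw [pow_succ, hLeib, ih, hf, Finset.Nat.sum_antidiagonal_succ', Finset.sum_mul, add_comm]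
    simp [pow_succ]

section CatalanRecursion

variable {R : Type*} [CommSemiring R] {a : ℕ → R}

theorem odd_eq_zero_of_antidiagonal_recursion (h1 : a 1 = 0)
    (h : ∀ m, a (m + 2) = ∑ p ∈ Finset.HasAntidiagonal.antidiagonal m, a p.1 * a p.2) (k : ℕ) :
    a (2 * k + 1) = 0 := by
  induction k using Nat.strong_induction_on with
  | _ k ih =>
    obtain _ | k := k
    · exact h1
    rw [show 2 * (k + 1) + 1 = (2 * k + 1) + 2 by ring, h]
    refine Finset.sum_eq_zero fun p hp => ?_
    rw [Finset.HasAntidiagonal.mem_antidiagonal] at hp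
    obtain ⟨i, hi | hi⟩ := Nat.even_or_odd' p.1
    · rw [show p.2 = 2 * (k - i) + 1 by lia, ih (k - i) (by lia), mul_zero]
    · rw [hi, ih i (by lia), zero_mul]

theorem even_eq_catalan_of_antidiagonal_recursion (h0 : a 0 = 1) (h1 : a 1 = 0)
    (h : ∀ m, a (m + 2) = ∑ p ∈ Finset.HasAntidiagonal.antidiagonal m, a p.1 * a p.2) (k : ℕ) :
    a (2 * k) = catalan k := by
  induction k using Nat.strong_induction_on with
  | _ k ih =>
    obtain _ | k := k
    · simp [h0]
    rw [show 2 * (k + 1) = 2 * k + 2 by ring, h, catalan_succ', Nat.cast_sum]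
    symm
    refine Finset.sum_of_injOn (fun p => (2 * p.1, 2 * p.2)) ?_ ?_ ?_ ?_
    · rintro ⟨i, j⟩ - ⟨i', j'⟩ - hp
      simpa using hp
    · rintro ⟨i, j⟩ hp
      simp only [Finset.mem_coe, Finset.HasAntidiagonal.mem_antidiagonal] at hp ⊢
      lia
    · rintro ⟨i, j⟩ hp hne
      rw [Finset.HasAntidiagonal.mem_antidiagonal] at hp
      obtain ⟨r, hr | hr⟩ := Nat.even_or_odd' i
      · refine absurd ⟨(r, k - r), ?_, ?_⟩ hne
        · simp only [Finset.mem_coe, Finset.HasAntidiagonal.mem_antidiagonal]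
          lia
        · simp only [Prod.mk.injEq]
          lia
      · simp [hr, odd_eq_zero_of_antidiagonal_recursion h1 h r]
    · rintro ⟨i, j⟩ hp
      rw [Finset.HasAntidiagonal.mem_antidiagonal] at hp
      simp [ih i (by lia), ih j (by lia)]

end CatalanRecursion

/-- **Stein identity + chain rule force semicircular (Catalan) moments.**
Let `A` be a unital `ℂ`-algebra, `τ : A → ℂ` linear with `τ(1) = 1`, and
`δ : A → A ⊗ A` a linear map satisfying the Leibniz rule.  If `f ∈ A` satisfies
`δ(f) = 1 ⊗ 1` and the Stein identity `τ(f^{m+1}) = (τ ⊗ τ)(δ(f^m))` for all `m ≥ 0`,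
then the moments of `f` are those of the standard semicircle law:
`τ(f^{2k}) = Catalan(k)` and `τ(f^{2k+1}) = 0`. -/
theorem stein_identity_semicircular_moments
    {A : Type*} [Ring A] [Algebra ℂ A]
    (τ : A →ₗ[ℂ] ℂ) (hτ1 : τ 1 = 1)
    (δ : A →ₗ[ℂ] A ⊗[ℂ] A)
    (hLeib : ∀ x y : A, δ (x * y) = δ x * ((1 : A) ⊗ₜ[ℂ] y) + (x ⊗ₜ[ℂ] (1 : A)) * δ y)
    (f : A) (hf : δ f = (1 : A) ⊗ₜ[ℂ] (1 : A))
    (hStein : ∀ m : ℕ, τ (f ^ (m + 1)) = tensorState τ (δ (f ^ m))) :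
    ∀ k : ℕ, τ (f ^ (2 * k)) = (catalan k : ℂ) ∧ τ (f ^ (2 * k + 1)) = 0 := by
  have h1 : τ (f ^ 1) = 0 := by
    have hδ : δ 1 = 0 := by simpa [← Algebra.TensorProduct.one_def] using hLeib 1 1
    simpa [hδ] using hStein 0
  have hrec : ∀ m, τ (f ^ (m + 2)) =
      ∑ p ∈ Finset.HasAntidiagonal.antidiagonal m, τ (f ^ p.1) * τ (f ^ p.2) := fun m => by
    rw [hStein (m + 1), leibniz_map_pow_succ δ hLeib hf, map_sum]
    simp [tensorState]
  exact fun k => ⟨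
    even_eq_catalan_of_antidiagonal_recursion (a := fun n => τ (f ^ n)) (by simpa) h1 hrec k,
    odd_eq_zero_of_antidiagonal_recursion (a := fun n => τ (f ^ n)) h1 hrec k⟩
end

section
/- For every natural number k, ∫_{−2}^{2} x^{2k} √(4 − x²) dx = 2π · Catalan(k) and ∫_{−2}^{2} x^{2k+1} √(4 − x²) dx = 0. Equivalently, the standard semicircle distribution μ_sc, the measure on [−2, 2] with density (2π)^{−1} √(4 − x²) with respect to Lebesgue measure, is a probability measure whose even moments are the Catalan numbers and whose odd moments vanish. -/
open MeasureTheory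

/-- The standard semicircle distribution: the measure on `[−2, 2]` with density
`(2π)⁻¹ √(4 − x²)` with respect to Lebesgue measure. -/
noncomputable def semicircleMeasure : Measure ℝ :=
  (volume.restrict (Set.Icc (-2 : ℝ) 2)).withDensity
    fun x => ENNReal.ofReal ((2 * Real.pi)⁻¹ * Real.sqrt (4 - x ^ 2))

lemma hasDerivAt_pow_mul_four_sub_sq_mul_sqrt (n : ℕ) {x : ℝ} (hx : 0 < 4 - x ^ 2) :
    HasDerivAt (fun y : ℝ => y ^ (n + 1) * ((4 - y ^ 2) * √(4 - y ^ 2)))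
      (4 * (n + 1) * (x ^ n * √(4 - x ^ 2)) - (n + 4) * (x ^ (n + 2) * √(4 - x ^ 2))) x := by
  have hq : HasDerivAt (fun y : ℝ => 4 - y ^ 2) (-(2 * x)) x := by
    simpa using (hasDerivAt_pow 2 x).const_sub 4
  convert! (hasDerivAt_pow (n + 1) x).mul (hq.mul (hq.sqrt hx.ne')) using 1
  have hs : √(4 - x ^ 2) ≠ 0 := (Real.sqrt_pos.2 hx).ne'
  have hsq := Real.sq_sqrt hx.le
  simp only [Nat.add_sub_cancel, Pi.mul_apply]
  push_cast
  field_simp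
  rw [hsq]
  ring

lemma integral_pow_add_two_mul_sqrt_four_sub_sq (n : ℕ) :
    (n + 4) * ∫ x in (-2 : ℝ)..2, x ^ (n + 2) * √(4 - x ^ 2) =
      4 * (n + 1) * ∫ x in (-2 : ℝ)..2, x ^ n * √(4 - x ^ 2) := by
  have hint (m : ℕ) : IntervalIntegrable (fun x : ℝ => x ^ m * √(4 - x ^ 2)) volume (-2) 2 :=
    Continuous.intervalIntegrable (by fun_prop) _ _
  have h := intervalIntegral.integral_eq_sub_of_hasDerivAt_of_le (by norm_num : (-2 : ℝ) ≤ 2)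
    (Continuous.continuousOn (by fun_prop))
    (fun x hx => hasDerivAt_pow_mul_four_sub_sq_mul_sqrt n (x := x) (by nlinarith [hx.1, hx.2]))
    (((hint n).const_mul _).sub ((hint (n + 2)).const_mul _))
  rw [intervalIntegral.integral_sub ((hint n).const_mul _) ((hint (n + 2)).const_mul _),
    intervalIntegral.integral_const_mul, intervalIntegral.integral_const_mul] at h
  norm_num at h
  linarith

lemma integral_sqrt_four_sub_sq : ∫ x in (-2 : ℝ)..2, √(4 - x ^ 2) = 2 * Real.pi := by
  have h := intervalIntegral.mul_integral_comp_mul_left (a := -1) (b := 1)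
    (f := fun x : ℝ => √(4 - x ^ 2)) (c := 2)
  have hscale (x : ℝ) : √(4 - (2 * x) ^ 2) = 2 * √(1 - x ^ 2) := by
    rw [show 4 - (2 * x) ^ 2 = 2 ^ 2 * (1 - x ^ 2) by ring, Real.sqrt_mul (by positivity),
      Real.sqrt_sq (by norm_num)]
  simp only [hscale, intervalIntegral.integral_const_mul, integral_sqrt_one_sub_sq] at h
  norm_num at h
  rw [← h]
  ring

lemma add_two_mul_catalan_succ (k : ℕ) :
    (k + 2) * catalan (k + 1) = 2 * (2 * k + 1) * catalan k := by
  have h₁ := succ_mul_catalan_eq_centralBinom k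
  have h₂ := succ_mul_catalan_eq_centralBinom (k + 1)
  have h₃ := Nat.succ_mul_centralBinom_succ k
  rw [← h₁, ← h₂] at h₃
  refine Nat.eq_of_mul_eq_mul_left k.succ_pos ?_
  rw [Nat.succ_eq_add_one]
  linarith

lemma integral_even_pow_mul_sqrt_four_sub_sq (k : ℕ) :
    ∫ x in (-2 : ℝ)..2, x ^ (2 * k) * √(4 - x ^ 2) = 2 * Real.pi * (catalan k : ℝ) := by
  induction k with
  | zero => simpa using integral_sqrt_four_sub_sq
  | succ k ih =>
    have h := integral_pow_add_two_mul_sqrt_four_sub_sq (2 * k)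
    have hc : ((k : ℝ) + 2) * catalan (k + 1) = 2 * (2 * k + 1) * catalan k := by
      exact_mod_cast add_two_mul_catalan_succ k
    rw [ih] at h
    push_cast at h
    refine mul_left_cancel₀ (by positivity : (2 * (k : ℝ) + 4) ≠ 0) ?_
    rw [show 2 * (k + 1) = 2 * k + 2 by ring, h]
    linear_combination (-4 * Real.pi) * hc

lemma integral_odd_pow_mul_sqrt_four_sub_sq (k : ℕ) :
    ∫ x in (-2 : ℝ)..2, x ^ (2 * k + 1) * √(4 - x ^ 2) = 0 := by
  have h := intervalIntegral.integral_comp_neg (a := -2) (b := 2)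
    (fun x : ℝ => x ^ (2 * k + 1) * √(4 - x ^ 2))
  simp only [(odd_two_mul_add_one k).neg_pow, neg_sq, neg_mul, intervalIntegral.integral_neg,
    neg_neg] at h
  linarith

lemma integral_semicircleMeasure (f : ℝ → ℝ) :
    ∫ x, f x ∂semicircleMeasure =
      (2 * Real.pi)⁻¹ * ∫ x in (-2 : ℝ)..2, f x * √(4 - x ^ 2) := by
  rw [semicircleMeasure, integral_withDensity_eq_integral_toReal_smul (by fun_prop)
    (by simp), intervalIntegral.integral_of_le (by norm_num), ← integral_Icc_eq_integral_Ioc,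
    ← integral_const_mul]
  refine integral_congr_ae (.of_forall fun x => ?_)
  simp only [smul_eq_mul]
  rw [ENNReal.toReal_ofReal (by positivity)]
  ring

instance isProbabilityMeasure_semicircleMeasure : IsProbabilityMeasure semicircleMeasure := by
  refine ⟨?_⟩
  have hint : Integrable (fun x : ℝ => (2 * Real.pi)⁻¹ * √(4 - x ^ 2))
      (volume.restrict (Set.Icc (-2) 2)) :=
    (Continuous.continuousOn (by fun_prop)).integrableOn_Icc
  rw [semicircleMeasure, withDensity_apply _ MeasurableSet.univ, Measure.restrict_univ,
    ← ofReal_integral_eq_lintegral_ofReal hint (.of_forall fun x => by positivity),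
    integral_const_mul, integral_Icc_eq_integral_Ioc,
    ← intervalIntegral.integral_of_le (by norm_num), integral_sqrt_four_sub_sq,
    inv_mul_cancel₀ (by positivity), ENNReal.ofReal_one]

/-- **Moments of the standard semicircle law are the Catalan numbers.**
`∫_{−2}^{2} x^{2k} √(4 − x²) dx = 2π·Catalan(k)` and the odd moments vanish;
equivalently, the standard semicircle distribution is a probability measure whose
even moments are the Catalan numbers and whose odd moments vanish. -/
theorem semicircle_moments :
    (∀ k : ℕ,
      ∫ x in (-2 : ℝ)..2, x ^ (2 * k) * Real.sqrt (4 - x ^ 2) =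
        2 * Real.pi * (catalan k : ℝ)) ∧
    (∀ k : ℕ,
      ∫ x in (-2 : ℝ)..2, x ^ (2 * k + 1) * Real.sqrt (4 - x ^ 2) = 0) ∧
    IsProbabilityMeasure semicircleMeasure ∧
    (∀ k : ℕ, ∫ x, x ^ (2 * k) ∂semicircleMeasure = (catalan k : ℝ)) ∧
    (∀ k : ℕ, ∫ x, x ^ (2 * k + 1) ∂semicircleMeasure = 0) := by
  refine ⟨integral_even_pow_mul_sqrt_four_sub_sq, integral_odd_pow_mul_sqrt_four_sub_sq,
    inferInstance, fun k => ?_, fun k => ?_⟩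
  · rw [integral_semicircleMeasure, integral_even_pow_mul_sqrt_four_sub_sq,
      inv_mul_cancel_left₀ (by positivity)]
  · rw [integral_semicircleMeasure, integral_odd_pow_mul_sqrt_four_sub_sq, mul_zero]
end
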